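/- Let N ≥ 1, h_1, …, h_N > 0, σ² > 0, α > 0, R̄_1, …, R̄_N ≥ 0, and P_max > 0. The power allocation problem is feasible — i.e., there exists p ≥ 0 with Σ_{i=1}^{N} p_i ≤ P_max and R_i(p) ≥ R̄_i for all i — if and only if (σ²/α)·Σ_{l=1}^{N} (Π_{m=1}^{l−1} 2^{R̄_m})·(2^{R̄_l} − 1)/h_l² ≤ P_max. -/

import Mathlib

open Finset

/-- Cumulative power `a_i = Σ_{l=i}^{N} p_l` (so `a_{N+1} = 0`). -/
noncomputable def cumPow (N : ℕ) (p : ℕ → ℝ) (i : ℕ) : ℝ := ∑ l ∈ Finset.Icc i N, p l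

/-- Per-user SIC rate `R_i(p) = log₂((hᵢ²·aᵢ(p) + c)/(hᵢ²·a_{i+1}(p) + c))`, `c = σ²/α`. -/
noncomputable def rate (N : ℕ) (h : ℕ → ℝ) (c : ℝ) (p : ℕ → ℝ) (i : ℕ) : ℝ :=
  Real.logb 2 (((h i) ^ 2 * cumPow N p i + c) / ((h i) ^ 2 * cumPow N p (i + 1) + c))

lemma cumPow_eq_add {N i : ℕ} (p : ℕ → ℝ) (hi : i ≤ N) :
    cumPow N p i = p i + cumPow N p (i + 1) := by
  rw [cumPow, cumPow, ← Finset.insert_Icc_add_one_left_eq_Icc hi, Finset.sum_insert (by simp)]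

lemma cumPow_of_lt {N i : ℕ} (p : ℕ → ℝ) (hi : N < i) : cumPow N p i = 0 := by
  simp [cumPow, Finset.Icc_eq_empty_of_lt hi]

lemma cumPow_nonneg {N i : ℕ} {p : ℕ → ℝ} (hi : 1 ≤ i)
    (hp : ∀ j ∈ Finset.Icc 1 N, 0 ≤ p j) : 0 ≤ cumPow N p i :=
  Finset.sum_nonneg fun j hj =>
    hp j (Finset.Icc_subset_Icc_left hi hj)

lemma cumPow_sub_succ {N i : ℕ} (a : ℕ → ℝ) (hi : i ≤ N + 1) :
    cumPow N (fun j => a j - a (j + 1)) i = a i - a (N + 1) := by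
  induction hi using Nat.decreasingInduction with
  | self => simp [cumPow_of_lt]
  | of_succ k hk ih => rw [cumPow_eq_add _ (by omega), ih]; ring

/-- The rate constraint is an affine inequality between consecutive cumulative powers. -/
lemma le_rate_iff {N i : ℕ} {h p : ℕ → ℝ} {c R : ℝ} (hc : 0 < c) (hh : 0 < h i)
    (h₀ : 0 ≤ cumPow N p i) (h₁ : 0 ≤ cumPow N p (i + 1)) :
    R ≤ rate N h c p i ↔
      c * (((2 : ℝ) ^ R - 1) / (h i) ^ 2) ≤
        cumPow N p i - (2 : ℝ) ^ R * cumPow N p (i + 1) := by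
  have hden : 0 < (h i) ^ 2 * cumPow N p (i + 1) + c := by positivity
  have hnum : 0 < (h i) ^ 2 * cumPow N p i + c := by positivity
  rw [rate, Real.le_logb_iff_rpow_le one_lt_two (div_pos hnum hden), le_div_iff₀ hden,
    ← mul_div_assoc, div_le_iff₀ (by positivity)]
  constructor <;> intro H <;> linarith

/-- Unrolling the first-order recurrence with multipliers `e` along `a 1, …, a (k + 1)`. -/
lemma sum_prod_mul_sub (e a : ℕ → ℝ) (k : ℕ) :
    ∑ l ∈ Finset.Icc 1 k, (∏ m ∈ Finset.Icc 1 (l - 1), e m) * (a l - e l * a (l + 1)) =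
      a 1 - (∏ m ∈ Finset.Icc 1 k, e m) * a (k + 1) := by
  induction k with
  | zero => simp
  | succ k ih =>
    rw [Finset.sum_Icc_succ_top (by omega), ih, Finset.prod_Icc_succ_top (by omega),
      Nat.add_sub_cancel]
    ring

lemma exists_backward_recurrence (e r : ℕ → ℝ) (N : ℕ) :
    ∃ a : ℕ → ℝ, a (N + 1) = 0 ∧ ∀ i ≤ N, a i = e i * a (i + 1) + r i := by
  let b : ℕ → ℝ := fun n => Nat.rec 0 (fun j x => e (N - j) * x + r (N - j)) n
  refine ⟨fun i => b (N + 1 - i), by simp [b], fun i hi => ?_⟩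
  have h₁ : N + 1 - i = (N - i) + 1 := by omega
  have h₂ : N + 1 - (i + 1) = N - i := by omega
  have h₃ : N - (N - i) = i := by omega
  simp only [h₁, h₂, b, h₃]

/-- the power allocation problem is feasible iff
`(σ²/α)·Σ_l (Π_{m<l} 2^{R̄ₘ})·(2^{R̄_l} − 1)/h_l² ≤ P_max`. -/
theorem feasibility_condition
    (N : ℕ) (hN : 1 ≤ N) (h Rbar : ℕ → ℝ) (σ2 α Pmax : ℝ)
    (hσ : 0 < σ2) (hα : 0 < α) (hP : 0 < Pmax)
    (hh : ∀ i ∈ Finset.Icc 1 N, 0 < h i)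
    (hR : ∀ i ∈ Finset.Icc 1 N, 0 ≤ Rbar i) :
    (∃ p : ℕ → ℝ, (∀ i ∈ Finset.Icc 1 N, 0 ≤ p i) ∧
        (∑ i ∈ Finset.Icc 1 N, p i ≤ Pmax) ∧
        (∀ i ∈ Finset.Icc 1 N, rate N h (σ2 / α) p i ≥ Rbar i)) ↔
      (σ2 / α) * ∑ l ∈ Finset.Icc 1 N,
        (∏ m ∈ Finset.Icc 1 (l - 1), (2 : ℝ) ^ (Rbar m)) *
          ((2 : ℝ) ^ (Rbar l) - 1) / (h l) ^ 2 ≤ Pmax := by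
  have hc : 0 < σ2 / α := div_pos hσ hα
  set c := σ2 / α
  have hW : ∀ k, 0 ≤ ∏ m ∈ Finset.Icc 1 k, (2 : ℝ) ^ (Rbar m) := fun k =>
    Finset.prod_nonneg fun m _ => by positivity
  have hsum : c * ∑ l ∈ Finset.Icc 1 N, (∏ m ∈ Finset.Icc 1 (l - 1), (2 : ℝ) ^ (Rbar m)) *
        ((2 : ℝ) ^ (Rbar l) - 1) / (h l) ^ 2 =
      ∑ l ∈ Finset.Icc 1 N, (∏ m ∈ Finset.Icc 1 (l - 1), (2 : ℝ) ^ (Rbar m)) *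
        (c * (((2 : ℝ) ^ (Rbar l) - 1) / (h l) ^ 2)) := by
    rw [Finset.mul_sum]
    exact Finset.sum_congr rfl fun l _ => by ring
  rw [hsum]
  constructor
  · rintro ⟨p, hp, hpP, hrate⟩
    refine le_trans (Finset.sum_le_sum fun l hl => mul_le_mul_of_nonneg_left
      ((le_rate_iff hc (hh l hl) (cumPow_nonneg (Finset.mem_Icc.1 hl).1 hp)
        (cumPow_nonneg (by omega) hp)).1 (hrate l hl)) (hW (l - 1))) ?_
    rw [sum_prod_mul_sub (fun m => (2 : ℝ) ^ (Rbar m)) (cumPow N p),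
      cumPow_of_lt p N.lt_succ_self, mul_zero, sub_zero]
    exact hpP
  · intro H
    obtain ⟨a, haN, ha⟩ := exists_backward_recurrence (fun m => (2 : ℝ) ^ (Rbar m))
      (fun l => c * (((2 : ℝ) ^ (Rbar l) - 1) / (h l) ^ 2)) N
    have hone : ∀ i ∈ Finset.Icc 1 N, 1 ≤ (2 : ℝ) ^ (Rbar i) := fun i hi =>
      Real.one_le_rpow one_le_two (hR i hi)
    have hr : ∀ i ∈ Finset.Icc 1 N, 0 ≤ c * (((2 : ℝ) ^ (Rbar i) - 1) / (h i) ^ 2) :=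
      fun i hi => mul_nonneg hc.le (div_nonneg (sub_nonneg.2 (hone i hi)) (sq_nonneg _))
    have hcum : ∀ i ≤ N + 1, cumPow N (fun j => a j - a (j + 1)) i = a i := fun i hi => by
      rw [cumPow_sub_succ a hi, haN, sub_zero]
    have ha₀ : ∀ i, i ≤ N + 1 → 1 ≤ i → 0 ≤ a i := by
      intro i hi
      induction hi using Nat.decreasingInduction with
      | self => exact fun _ => haN.ge
      | of_succ k hk ih =>
        intro hk₁
        rw [ha k (by omega)]
        exact add_nonneg (mul_nonneg (by positivity) (ih (by omega)))
          (hr k (Finset.mem_Icc.2 ⟨hk₁, by omega⟩))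
    refine ⟨fun j => a j - a (j + 1), fun i hi => ?_, ?_, fun i hi => ?_⟩
    · have hi' := Finset.mem_Icc.1 hi
      have h₁ := ha i hi'.2
      have h₂ := le_mul_of_one_le_left (ha₀ (i + 1) (by omega) (by omega)) (hone i hi)
      have h₃ := hr i hi
      dsimp only at h₁ ⊢
      linarith
    · have h₁ := hcum 1 (by omega)
      have h₂ := sum_prod_mul_sub (fun m => (2 : ℝ) ^ (Rbar m)) a N
      rw [haN, mul_zero, sub_zero] at h₂
      rw [cumPow] at h₁
      rw [h₁, ← h₂]
      refine le_of_eq_of_le (Finset.sum_congr rfl fun l hl => ?_) H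
      rw [ha l (Finset.mem_Icc.1 hl).2, add_sub_cancel_left]
    · obtain ⟨hi₁, hi₂⟩ := Finset.mem_Icc.1 hi
      have h₀ := hcum i (by omega)
      have h₁ := hcum (i + 1) (by omega)
      refine (le_rate_iff hc (hh i hi) (h₀ ▸ ha₀ i (by omega) hi₁)
        (h₁ ▸ ha₀ (i + 1) (by omega) (by omega))).2 ?_
      rw [h₀, h₁, ha i hi₂, add_sub_cancel_left]
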